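/- Let λ = (λ_1 ≥ … ≥ λ_ℓ ≥ 0) be a partition with at most ℓ parts, let x = (x_1,…,x_n), let γ be a further variable, and let t = (t_1,…,t_{ℓ−1}). Then the following branching rule holds: g_λ(x_1,…,x_n,γ; t_1,…,t_{ℓ−1}) = Σ_{μ ⊆ λ} γ^{λ_1−μ_1} · (∏_{i=2}^{ℓ} t_{i−1}^{λ_i−μ_i}) · g_μ(x_1,…,x_n; γ, t_1,…,t_{ℓ−2}), where the sum is over all partitions μ with μ_i ≤ λ_i for all i, and on the right-hand side the parameter sequence of g_μ is (γ, t_1, t_2, …), of which only the first ℓ(μ)−1 entries occur (in particular t_{ℓ−1} never occurs on the right). -/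

import Mathlib

open scoped Classical

noncomputable section

variable {R : Type*} [CommRing R]

/-- The boxes of the Young diagram with row lengths `lam 0, …, lam (ℓ-1)`
(a box in row `r < ℓ` and column `c < lam r`, both 0-indexed). -/
abbrev YBox (ℓ : ℕ) (lam : ℕ → ℕ) : Type := Σ r : Fin ℓ, Fin (lam r.1)

/-- A reverse plane partition of skew shape `lam/mu` with entries in `{1, …, n}`,
encoded as a filling of the boxes of `lam` by values in `Fin (n+1)`, where the
value `0` is used exactly on the boxes of `mu`; rows weakly increase and
columns weakly increase. -/
def IsSkewRPP (ℓ n : ℕ) (lam mu : ℕ → ℕ) (T : YBox ℓ lam → Fin (n + 1)) : Prop :=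
  (∀ b : YBox ℓ lam, ((T b : ℕ) = 0 ↔ (b.2 : ℕ) < mu b.1.1)) ∧
  (∀ (r : Fin ℓ) (c c' : Fin (lam r.1)), mu r.1 ≤ (c : ℕ) → (c : ℕ) ≤ (c' : ℕ) →
    T ⟨r, c⟩ ≤ T ⟨r, c'⟩) ∧
  (∀ (r r' : Fin ℓ) (c : Fin (lam r.1)) (c' : Fin (lam r'.1)),
    (r : ℕ) ≤ (r' : ℕ) → (c : ℕ) = (c' : ℕ) → mu r.1 ≤ (c : ℕ) → mu r'.1 ≤ (c' : ℕ) →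
    T ⟨r, c⟩ ≤ T ⟨r', c'⟩)

/-- The weight of a box `b` of the skew shape `lam/mu` in a reverse plane
partition `T`: it is `t (r+1)` (`r+1` being the 1-indexed row of `b`) if the box
directly below `b` exists (in `lam`) and carries the same entry, and `x e`
otherwise, where `e ∈ {1, …, n}` is the entry of `b`.  Boxes of `mu` have
weight `1`. -/
def boxWeight (ℓ n : ℕ) (lam mu : ℕ → ℕ) (x t : ℕ → R)
    (T : YBox ℓ lam → Fin (n + 1)) (b : YBox ℓ lam) : R :=
  if mu b.1.1 ≤ (b.2 : ℕ) then
    if ∃ (hr : (b.1 : ℕ) + 1 < ℓ) (hc : (b.2 : ℕ) < lam ((b.1 : ℕ) + 1)),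
        T ⟨⟨(b.1 : ℕ) + 1, hr⟩, ⟨(b.2 : ℕ), hc⟩⟩ = T b
      then t ((b.1 : ℕ) + 1)
      else x (T b : ℕ)
  else 1

/-- The (skew) refined dual Grothendieck polynomial `g_{lam/mu}(x; t)`:
the sum of `∏_r t_r^{b_r(T)} ∏_i x_i^{a_i(T)}` over all reverse plane
partitions `T` of shape `lam/mu` with entries in `{1, …, n}`, where `b_r(T)`
is the number of boxes in row `r` whose entry equals that of the box directly
below it, and `a_i(T)` is the number of columns containing the entry `i`. -/
def dualGroth (ℓ n : ℕ) (lam mu : ℕ → ℕ) (x t : ℕ → R) : R :=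
  ∑ T ∈ Finset.univ.filter (IsSkewRPP ℓ n lam mu),
    ∏ b : YBox ℓ lam, boxWeight ℓ n lam mu x t T b

/-- Complete homogeneous symmetric function `h_k` of the entries of a list. -/
def hL (k : ℕ) (L : List R) : R :=
  ∑ f ∈ Finset.univ.filter (fun f : Fin k → Fin L.length => Monotone f),
    ∏ i, L.get (f i)

/-- Elementary symmetric function `e_k` of the entries of a list. -/
def eL (k : ℕ) (L : List R) : R :=
  ∑ f ∈ Finset.univ.filter (fun f : Fin k → Fin L.length => StrictMono f),
    ∏ i, L.get (f i)

/-- `h_d` for an integer degree `d`, with `h_d = 0` for `d < 0`. -/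
def hInt (d : ℤ) (L : List R) : R := if 0 ≤ d then hL d.toNat L else 0

/-- `e_d` for an integer degree `d`, with `e_d = 0` for `d < 0`. -/
def eInt (d : ℤ) (L : List R) : R := if 0 ≤ d then eL d.toNat L else 0

/-- Extend a function on `Fin ℓ` to `ℕ` by `0`. -/
def extendFin (ℓ : ℕ) (p : Fin ℓ → ℕ) : ℕ → ℕ :=
  fun r => if h : r < ℓ then p ⟨r, h⟩ else 0

/-- A semistandard Young tableau of shape `lam` with entries in `{1, …, N}`
(encoded with values in `Fin (N+1)`, the value `0` being unused): rows weakly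
increase and columns strictly increase. -/
def IsSSYT (ℓ N : ℕ) (lam : ℕ → ℕ) (T : YBox ℓ lam → Fin (N + 1)) : Prop :=
  (∀ b : YBox ℓ lam, 1 ≤ (T b : ℕ)) ∧
  (∀ (r : Fin ℓ) (c c' : Fin (lam r.1)), (c : ℕ) ≤ (c' : ℕ) → T ⟨r, c⟩ ≤ T ⟨r, c'⟩) ∧
  (∀ (r r' : Fin ℓ) (c : Fin (lam r.1)) (c' : Fin (lam r'.1)),
    (r : ℕ) < (r' : ℕ) → (c : ℕ) = (c' : ℕ) → T ⟨r, c⟩ < T ⟨r', c'⟩)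

/-- The Schur polynomial `s_lam (z 1, …, z N)`: the sum of `z^T` over all
semistandard Young tableaux of shape `lam` with entries in `{1, …, N}`. -/
def schurPoly (ℓ N : ℕ) (lam : ℕ → ℕ) (z : ℕ → R) : R :=
  ∑ T ∈ Finset.univ.filter (IsSSYT ℓ N lam),
    ∏ b : YBox ℓ lam, z (T b : ℕ)


/-- Extend a dependent tuple `p i ≤ lam i` (a partition `μ ⊆ λ`) to a function
`ℕ → ℕ`, by `0` outside `Fin ℓ`. -/
def extendDep (ℓ : ℕ) (lam : ℕ → ℕ) (p : (i : Fin ℓ) → Fin (lam i.1 + 1)) : ℕ → ℕ :=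
  fun r => if h : r < ℓ then (p ⟨r, h⟩ : ℕ) else 0

/-- The sum over the entry `v` of one row in the row-by-row evaluation of a product of two
branching matrices; `P v` is the contribution of the rows above. -/
def rowSum {R : Type*} [CommRing R] (l l' : ℕ) (x y t : R) (P : ℕ → R) (m : ℕ) : R :=
  ∑ v ∈ Finset.Icc m l, t ^ (l' - v) * x ^ (l - max v l') * y ^ (v - m) * P v

/-- The relation between the partial row sums of the two products of branching matrices that
is preserved when a row is added. -/
def RowCompat {R : Type*} [CommRing R] (l : ℕ) (x y : R) (P Q : ℕ → R) : Prop :=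
  P l = Q l ∧ ∀ m < l, x ^ (l - m) * (P m - P (m + 1)) = y ^ (l - m) * (Q m - Q (m + 1))

theorem rowSum_eq_add {R : Type*} [CommRing R] {l l' m : ℕ} (x y t : R) (P : ℕ → R) (hm : m ≤ l) :
    rowSum l l' x y t P m =
      t ^ (l' - m) * x ^ (l - max m l') * P m + y * rowSum l l' x y t P (m + 1) := by
  unfold rowSum
  rw [← Finset.insert_Icc_add_one_left_eq_Icc hm, Finset.sum_insert (by simp), Finset.mul_sum]
  congr 1
  · simp
  · refine Finset.sum_congr rfl fun v hv => ?_
    have h := (Finset.mem_Icc.mp hv).1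
    rw [show v - m = v - (m + 1) + 1 by omega]
    ring

theorem rowSum_of_lt {R : Type*} [CommRing R] {l l' m : ℕ} (x y t : R) (P : ℕ → R) (hm : l < m) :
    rowSum l l' x y t P m = 0 := by
  simp [rowSum, Finset.Icc_eq_empty_of_lt hm]

theorem rowSum_eq_of_le {R : Type*} [CommRing R] {l l' m : ℕ} (x y t t' : R) (P : ℕ → R)
    (hm : l' ≤ m) : rowSum l l' x y t P m = rowSum l 0 x y t' P m := by
  refine Finset.sum_congr rfl fun v hv => ?_
  have h := (Finset.mem_Icc.mp hv).1
  rw [show l' - v = 0 by omega, show max v l' = max v 0 by omega]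
  simp

theorem rowSum_same {R : Type*} [CommRing R] {l l' m : ℕ} (x y t : R) (P : ℕ → R)
    (hl : l' ≤ l) : rowSum l l' x y x P m = rowSum l 0 x y t P m := by
  refine Finset.sum_congr rfl fun v hv => ?_
  have h := (Finset.mem_Icc.mp hv).2
  rw [← pow_add, show l' - v + (l - max v l') = l - max v 0 by omega]
  simp

/-- The second-order recursion for `rowSum`, symmetric in `x` and `y` up to the first term. -/
theorem rowSum_recursion {R : Type*} [CommRing R] {l m : ℕ} (x y t : R) (P : ℕ → R)
    (hm : m < l) :
    rowSum l 0 x y t P m = x ^ (l - m) * (P m - P (m + 1))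
      + (x + y) * rowSum l 0 x y t P (m + 1) - x * y * rowSum l 0 x y t P (m + 2) := by
  rw [rowSum_eq_add x y t P hm.le, rowSum_eq_add x y t P (Nat.succ_le_of_lt hm)]
  simp only [Nat.zero_sub, Nat.max_zero, pow_zero, Nat.succ_eq_add_one]
  rw [show l - m = l - (m + 1) + 1 by omega]
  ring

theorem RowCompat.rowSum_eq {R : Type*} [CommRing R] {l : ℕ} {x y : R} {P Q : ℕ → R}
    (h : RowCompat l x y P Q) (t : R) (m : ℕ) :
    rowSum l 0 x y t P m = rowSum l 0 y x t Q m := by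
  suffices H : ∀ k m, l ≤ m + k → rowSum l 0 x y t P m = rowSum l 0 y x t Q m from
    H l m (by omega)
  intro k
  induction k using Nat.strong_induction_on with
  | _ k ih =>
    intro m hm
    rcases lt_trichotomy m l with hlt | rfl | hgt
    · rw [rowSum_recursion x y t P hlt, rowSum_recursion y x t Q hlt, h.2 m hlt,
        ih (k - 1) (by omega) (m + 1) (by omega), ih (k - 1) (by omega) (m + 2) (by omega)]
      ring
    · simp [rowSum, h.1]
    · rw [rowSum_of_lt _ _ _ _ hgt, rowSum_of_lt _ _ _ _ hgt]

theorem pow_mul_rowSum_sub {R : Type*} [CommRing R] {l l' m : ℕ} (x y t : R) (P : ℕ → R)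
    (hl : l' ≤ l) (hm : m < l') :
    x ^ (l' - m) * (rowSum l l' x y t P m - y * rowSum l l' x y t P (m + 1)) =
      t ^ (l' - m) * (rowSum l 0 x y 0 P m - y * rowSum l 0 x y 0 P (m + 1)) := by
  rw [rowSum_eq_add x y t P (hm.le.trans hl), rowSum_eq_add x y 0 P (hm.le.trans hl),
    max_eq_right hm.le, max_eq_left (Nat.zero_le m), show l - m = (l' - m) + (l - l') by omega,
    pow_add]
  simp
  ring

theorem rowSum_step_of_eq {R : Type*} [CommRing R] {l l' : ℕ} {x y t : R} {P Q : ℕ → R}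
    (h : RowCompat l x y P Q) (hl : l' ≤ l) {m : ℕ} (hm : m < l') :
    x ^ (l' - m) * (rowSum l l' x y t P m - t * rowSum l l' x y t P (m + 1)) =
      y ^ (l' - m) * (rowSum l l' y x t Q m - t * rowSum l l' y x t Q (m + 1)) := by
  obtain ⟨k, rfl⟩ := Nat.exists_eq_add_of_lt hm
  induction k generalizing m with
  | zero =>
    have h1 := pow_mul_rowSum_sub x y t P hl hm
    have h2 := pow_mul_rowSum_sub y x t Q hl hm
    rw [← h.rowSum_eq 0, ← h.rowSum_eq 0] at h2
    have h3 : rowSum l (m + 0 + 1) x y t P (m + 1) = rowSum l 0 x y 0 P (m + 1) :=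
      rowSum_eq_of_le _ _ _ _ _ (by omega)
    have h4 : rowSum l (m + 0 + 1) y x t Q (m + 1) = rowSum l 0 x y 0 P (m + 1) := by
      rw [h.rowSum_eq]; exact rowSum_eq_of_le _ _ _ _ _ (by omega)
    rw [h3] at h1 ⊢
    rw [h4] at h2 ⊢
    simp only [add_zero, Nat.add_sub_cancel_left, pow_one] at h1 h2 ⊢
    linear_combination h1 - h2
  | succ k ih =>
    have h1 := pow_mul_rowSum_sub x y t P hl hm
    have h2 := pow_mul_rowSum_sub y x t Q hl hm
    have h3 := pow_mul_rowSum_sub x y t P (m := m + 1) hl (by omega)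
    have h4 := pow_mul_rowSum_sub y x t Q (m := m + 1) hl (by omega)
    rw [← h.rowSum_eq 0, ← h.rowSum_eq 0] at h2 h4
    have h5 := ih (m := m + 1) (by omega) (by omega)
    rw [show m + 1 + k + 1 = m + (k + 1) + 1 by omega] at h5
    have e : m + (k + 1) + 1 - m = (m + (k + 1) + 1 - (m + 1)) + 1 := by omega
    rw [e, pow_succ, pow_succ] at h1 h2 ⊢
    linear_combination h1 - h2 - t * x * h3 + t * y * h4 + x * y * h5

/-- Adding a row preserves `RowCompat`, for either of the two admissible choices of
parameters. -/
theorem RowCompat.step {R : Type*} [CommRing R] {l l' : ℕ} {x y y' t a : R} {P Q : ℕ → R}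
    (h : RowCompat l x y P Q) (hl : l' ≤ l) (ht : (t = a ∧ y' = y) ∨ (a = y ∧ t = y')) (k : ℕ) :
    RowCompat l' x y' (fun m => a ^ (m - k) * rowSum l l' x y t P (max m k))
      (fun m => a ^ (m - k) * rowSum l l' y x a Q (max m k)) := by
  refine ⟨?_, fun m hm => ?_⟩
  · dsimp only
    rw [rowSum_eq_of_le x y t 0 P (le_max_left _ _), rowSum_eq_of_le y x a 0 Q (le_max_left _ _),
      h.rowSum_eq]
  · dsimp only
    rcases lt_or_ge m k with hk | hk
    · rw [max_eq_right hk.le, max_eq_right (Nat.succ_le_of_lt hk), show m - k = 0 by omega,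
        show m + 1 - k = 0 by omega]
      ring
    · rw [max_eq_left hk, max_eq_left (hk.trans m.le_succ), show m + 1 - k = m - k + 1 by omega,
        pow_succ]
      rcases ht with ⟨rfl, rfl⟩ | ⟨rfl, rfl⟩
      · linear_combination t ^ (m - k) * rowSum_step_of_eq (t := t) h hl hm
      · have h1 := pow_mul_rowSum_sub x a t P hl hm
        rw [rowSum_same a x 0 Q hl, rowSum_same a x 0 Q hl, ← h.rowSum_eq, ← h.rowSum_eq]
        linear_combination a ^ (m - k) * h1

/-- The row-by-row evaluation of a chain sum over weakly decreasing `ν` with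
`lo i ≤ ν i ≤ hi i`, where consecutive entries interact through `K`. -/
def chainSum {R : Type*} [CommRing R] (lo hi : ℕ → ℕ) (K : ℕ → ℕ → ℕ → R) : ℕ → ℕ → R
  | 0, _ => 1
  | i + 1, m => ∑ v ∈ Finset.Icc (max m (lo i)) (hi i), K i v m * chainSum lo hi K i v

theorem sum_piFinset_prod_eq_chainSum {R : Type*} [CommRing R] (lo hi : ℕ → ℕ)
    (K : ℕ → ℕ → ℕ → R) (ℓ m : ℕ) :
    ∑ ν ∈ Fintype.piFinset (fun i : Fin ℓ => Finset.Icc (lo i) (hi i)),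
      ∏ i : Fin ℓ, (if Fin.snoc (α := fun _ => ℕ) ν m i.succ ≤
          Fin.snoc (α := fun _ => ℕ) ν m i.castSucc
        then K i (Fin.snoc (α := fun _ => ℕ) ν m i.castSucc)
          (Fin.snoc (α := fun _ => ℕ) ν m i.succ) else 0) = chainSum lo hi K ℓ m := by
  induction ℓ generalizing m with
  | zero => simp [chainSum]
  | succ ℓ ih =>
    have hIcc : Finset.Icc (max m (lo ℓ)) (hi ℓ) =
        (Finset.Icc (lo ℓ) (hi ℓ)).filter (fun v => m ≤ v) := by
      ext v; simp; tauto
    rw [chainSum, hIcc, Finset.sum_filter]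
    simp_rw [← ih, ← ite_zero_mul, Finset.mul_sum]
    rw [← Finset.sum_product']
    refine Finset.sum_nbij' (fun p => (p (Fin.last ℓ), Fin.init p))
      (fun q => Fin.snoc (α := fun _ => ℕ) q.2 q.1) ?_ ?_ ?_ ?_ ?_
    · intro p hp
      rw [Fintype.mem_piFinset] at hp
      rw [Finset.mem_product, Fintype.mem_piFinset]
      exact ⟨hp (Fin.last ℓ), fun i => hp i.castSucc⟩
    · rintro ⟨v, q⟩ hq
      rw [Finset.mem_product, Fintype.mem_piFinset] at hq
      rw [Fintype.mem_piFinset]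
      refine Fin.lastCases ?_ (fun i => ?_)
      · simpa using hq.1
      · simpa using hq.2 i
    · intro p _
      exact Fin.snoc_init_self p
    · rintro ⟨v, q⟩ _
      simp
    · intro p _
      rw [Fin.prod_univ_castSucc, mul_comm]
      congr 1
      · simp
      · refine Finset.prod_congr rfl fun i _ => ?_
        have h1 : Fin.snoc (α := fun _ => ℕ) (Fin.init p) (p (Fin.last ℓ)) = p :=
          Fin.snoc_init_self p
        rw [h1, Fin.succ_castSucc, Fin.snoc_castSucc, Fin.snoc_castSucc, Fin.val_castSucc]

/-- The antitone sequences between `μ` and `lam`. -/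
def partitionsBetween {ℓ : ℕ} (μ lam : Fin ℓ → ℕ) : Finset (Fin ℓ → ℕ) :=
  (Finset.Icc μ lam).filter Antitone

theorem extendFin_of_lt {ℓ : ℕ} (p : Fin ℓ → ℕ) {i : ℕ} (h : i < ℓ) :
    extendFin ℓ p i = p ⟨i, h⟩ := dif_pos h

theorem extendFin_of_le {ℓ : ℕ} (p : Fin ℓ → ℕ) {i : ℕ} (h : ℓ ≤ i) :
    extendFin ℓ p i = 0 := dif_neg (by omega)

theorem extendFin_val {ℓ : ℕ} (p : Fin ℓ → ℕ) (i : Fin ℓ) : extendFin ℓ p i = p i :=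
  extendFin_of_lt p i.2

theorem extendFin_antitone {ℓ : ℕ} {p : Fin ℓ → ℕ} (hp : Antitone p) :
    Antitone (extendFin ℓ p) := by
  intro a b hab
  by_cases hb : b < ℓ
  · rw [extendFin_of_lt p hb, extendFin_of_lt p (hab.trans_lt hb)]
    exact hp hab
  · rw [extendFin_of_le p (by omega)]
    exact Nat.zero_le _

theorem snoc_zero_eq_extendFin {ℓ : ℕ} (p : Fin ℓ → ℕ) (i : Fin (ℓ + 1)) :
    Fin.snoc (α := fun _ => ℕ) p 0 i = extendFin ℓ p i := by
  refine Fin.lastCases ?_ (fun j => ?_) i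
  · simp [extendFin]
  · simp [extendFin]

theorem antitone_iff_extendFin_succ_le {ℓ : ℕ} (p : Fin ℓ → ℕ) :
    Antitone p ↔ ∀ i : Fin ℓ, extendFin ℓ p (i + 1) ≤ extendFin ℓ p i := by
  refine ⟨fun hp i => extendFin_antitone hp (Nat.le_succ _), fun h => ?_⟩
  have H : Antitone (extendFin ℓ p) := antitone_nat_of_succ_le fun n => by
    by_cases hn : n < ℓ
    · exact h ⟨n, hn⟩
    · rw [extendFin_of_le p (by omega)]
      exact Nat.zero_le _
  intro a b hab
  rw [← extendFin_val p, ← extendFin_val p]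
  exact H hab

theorem sum_partitionsBetween_prod {R : Type*} [CommRing R] {ℓ : ℕ} (μ lam : Fin ℓ → ℕ)
    (K : ℕ → ℕ → ℕ → R) :
    ∑ ν ∈ partitionsBetween μ lam,
      ∏ i ∈ Finset.range ℓ, K i (extendFin ℓ ν i) (extendFin ℓ ν (i + 1)) =
    chainSum (extendFin ℓ μ) (extendFin ℓ lam) K ℓ 0 := by
  rw [← sum_piFinset_prod_eq_chainSum, partitionsBetween, Finset.sum_filter]
  have hset : Fintype.piFinset (fun i : Fin ℓ =>
      Finset.Icc (extendFin ℓ μ i) (extendFin ℓ lam i)) = Finset.Icc μ lam := by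
    ext ν
    simp [extendFin_val, Pi.le_def, forall_and]
  rw [hset]
  refine Finset.sum_congr rfl fun ν _ => ?_
  rw [Fintype.prod_ite_zero, Finset.prod_range]
  simp only [snoc_zero_eq_extendFin, Fin.val_castSucc, Fin.val_succ]
  simp only [antitone_iff_extendFin_succ_le]

/-- The matrix entry indexed by the partitions `L` and `N` of the operator adding one letter:
in row `i`, boxes of `L / N` above a box of `L` weigh `t i`, the others weigh `x i`. -/
def branchWeight {R : Type*} [CommRing R] (ℓ : ℕ) (x t : ℕ → R) (L N : ℕ → ℕ) : R :=
  ∏ i ∈ Finset.range ℓ, t i ^ (L (i + 1) - N i) * x i ^ (L i - max (N i) (L (i + 1)))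

theorem chainSum_rowCompat {R : Type*} [CommRing R] (L M : ℕ → ℕ) (hL : Antitone L)
    (x : R) (y t a : ℕ → R)
    (h : ∀ i, (t i = a i ∧ y (i + 1) = y i) ∨ (a i = y i ∧ t i = y (i + 1))) (i : ℕ) :
    RowCompat (L i) x (y i)
      (chainSum M L (fun i v m => t i ^ (L (i + 1) - v) * x ^ (L i - max v (L (i + 1))) *
        (a i ^ (m - M i) * y i ^ (v - max (M i) m))) i)
      (chainSum M L (fun i v m => a i ^ (L (i + 1) - v) * y i ^ (L i - max v (L (i + 1))) *
        (a i ^ (m - M i) * x ^ (v - max (M i) m))) i) := by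
  induction i with
  | zero => exact ⟨rfl, fun m _ => by simp [chainSum]⟩
  | succ i ih =>
    convert ih.step (hL i.le_succ) (h i) (M i) using 1 <;>
    · funext m
      rw [chainSum, rowSum, Finset.mul_sum]
      refine Finset.sum_congr rfl fun v _ => ?_
      rw [max_comm (M i) m]
      ring

theorem sum_branchWeight_comm {R : Type*} [CommRing R] {ℓ : ℕ} (μ lam : Fin ℓ → ℕ)
    (hlam : Antitone lam) (x : R) (y t a : ℕ → R)
    (h : ∀ i, (t i = a i ∧ y (i + 1) = y i) ∨ (a i = y i ∧ t i = y (i + 1))) :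
    ∑ ν ∈ partitionsBetween μ lam,
        branchWeight ℓ (fun _ => x) t (extendFin ℓ lam) (extendFin ℓ ν) *
          branchWeight ℓ y a (extendFin ℓ ν) (extendFin ℓ μ) =
      ∑ ν ∈ partitionsBetween μ lam,
        branchWeight ℓ y a (extendFin ℓ lam) (extendFin ℓ ν) *
          branchWeight ℓ (fun _ => x) a (extendFin ℓ ν) (extendFin ℓ μ) := by
  have H := (chainSum_rowCompat (extendFin ℓ lam) (extendFin ℓ μ) (extendFin_antitone hlam)
    x y t a h ℓ).1
  rw [extendFin_of_le lam le_rfl, ← sum_partitionsBetween_prod,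
    ← sum_partitionsBetween_prod] at H
  simpa only [branchWeight, Finset.prod_mul_distrib] using H

theorem sum_partitionsBetween_comm {R : Type*} [CommRing R] {ℓ : ℕ} (lam : Fin ℓ → ℕ)
    (A B : (Fin ℓ → ℕ) → (Fin ℓ → ℕ) → R) (G : (Fin ℓ → ℕ) → R) :
    ∑ ν ∈ partitionsBetween 0 lam, A lam ν * ∑ μ ∈ partitionsBetween 0 ν, B ν μ * G μ =
      ∑ μ ∈ partitionsBetween 0 lam,
        (∑ ν ∈ partitionsBetween μ lam, A lam ν * B ν μ) * G μ := by
  simp_rw [Finset.mul_sum, Finset.sum_mul]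
  rw [Finset.sum_comm' (t' := partitionsBetween 0 lam) (s' := fun μ => partitionsBetween μ lam)]
  · simp only [mul_assoc]
  · intro ν μ
    simp only [partitionsBetween, Finset.mem_filter, Finset.mem_Icc]
    constructor
    · rintro ⟨⟨⟨h1, h2⟩, h3⟩, ⟨h4, h5⟩, h6⟩
      exact ⟨⟨⟨h5, h2⟩, h3⟩, ⟨h4, h5.trans h2⟩, h6⟩
    · rintro ⟨⟨⟨h1, h2⟩, h3⟩, ⟨h4, h5⟩, h6⟩
      exact ⟨⟨⟨h4.trans h1, h2⟩, h3⟩, ⟨h4, h1⟩, h6⟩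

theorem branchWeight_comm_apply {R : Type*} [CommRing R] {ℓ : ℕ} (lam : Fin ℓ → ℕ)
    (hlam : Antitone lam) (x : R) (y t a : ℕ → R)
    (h : ∀ i, (t i = a i ∧ y (i + 1) = y i) ∨ (a i = y i ∧ t i = y (i + 1)))
    (G : (Fin ℓ → ℕ) → R) :
    ∑ ν ∈ partitionsBetween 0 lam,
        branchWeight ℓ (fun _ => x) t (extendFin ℓ lam) (extendFin ℓ ν) *
          ∑ μ ∈ partitionsBetween 0 ν,
            branchWeight ℓ y a (extendFin ℓ ν) (extendFin ℓ μ) * G μ =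
      ∑ ν ∈ partitionsBetween 0 lam,
        branchWeight ℓ y a (extendFin ℓ lam) (extendFin ℓ ν) *
          ∑ μ ∈ partitionsBetween 0 ν,
            branchWeight ℓ (fun _ => x) a (extendFin ℓ ν) (extendFin ℓ μ) * G μ := by
  rw [sum_partitionsBetween_comm lam
      (fun lam ν => branchWeight ℓ (fun _ => x) t (extendFin ℓ lam) (extendFin ℓ ν))
      (fun ν μ => branchWeight ℓ y a (extendFin ℓ ν) (extendFin ℓ μ)),
    sum_partitionsBetween_comm lam
      (fun lam ν => branchWeight ℓ y a (extendFin ℓ lam) (extendFin ℓ ν))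
      (fun ν μ => branchWeight ℓ (fun _ => x) a (extendFin ℓ ν) (extendFin ℓ μ))]
  exact Finset.sum_congr rfl fun μ _ => by rw [sum_branchWeight_comm μ lam hlam x y t a h]

/-- The polynomial obtained from the empty partition by adding the letters
`x 1, …, x n` one at a time. -/
def branchPoly {R : Type*} [CommRing R] {ℓ : ℕ} (x t : ℕ → R) : ℕ → (Fin ℓ → ℕ) → R
  | 0, lam => if lam = 0 then 1 else 0
  | n + 1, lam => ∑ ν ∈ partitionsBetween 0 lam,
      branchWeight ℓ (fun _ => x (n + 1)) t (extendFin ℓ lam) (extendFin ℓ ν) *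
        branchPoly x t n ν

theorem branchPoly_congr {R : Type*} [CommRing R] {ℓ : ℕ} {x x' : ℕ → R} (t : ℕ → R) {n : ℕ}
    (h : ∀ k, k ≤ n → x k = x' k) (lam : Fin ℓ → ℕ) :
    branchPoly x t n lam = branchPoly x' t n lam := by
  induction n generalizing lam with
  | zero => rfl
  | succ n ih =>
    simp only [branchPoly, h (n + 1) le_rfl, ih fun k hk => h k (hk.trans n.le_succ)]

theorem prod_range_telescope {R : Type*} [CommRing R] (s : ℕ → R) (L : ℕ → ℕ) (hL : Antitone L)
    (k : ℕ) :
    (∏ i ∈ Finset.range k, s (i + 1) ^ L (i + 1) * s 0 ^ (L i - L (i + 1))) * s 0 ^ L k =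
      ∏ i ∈ Finset.range (k + 1), s i ^ L i := by
  induction k with
  | zero => simp
  | succ k ih =>
    rw [Finset.prod_range_succ, Finset.prod_range_succ _ (k + 1), ← ih,
      ← Nat.sub_add_cancel (hL k.le_succ), pow_add]
    simp only [Nat.add_sub_cancel]
    ring

theorem sum_branchWeight_mul_branchPoly {R : Type*} [CommRing R] {ℓ : ℕ} (x s : ℕ → R) (n : ℕ)
    (lam : Fin ℓ → ℕ) (hlam : Antitone lam) :
    ∑ ν ∈ partitionsBetween 0 lam,
        branchWeight ℓ (fun _ => s 0) (fun i => s (i + 1)) (extendFin ℓ lam) (extendFin ℓ ν) *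
          branchPoly x (fun i => s (i + 1)) n ν =
      ∑ ν ∈ partitionsBetween 0 lam,
        branchWeight ℓ s s (extendFin ℓ lam) (extendFin ℓ ν) * branchPoly x s n ν := by
  induction n generalizing lam with
  | zero =>
    have h0 : (0 : Fin ℓ → ℕ) ∈ partitionsBetween 0 lam := by
      simp [partitionsBetween, Antitone]
    have hL := extendFin_antitone hlam
    have e : extendFin ℓ (0 : Fin ℓ → ℕ) = 0 := by
      funext i
      simp [extendFin]
    simp only [branchPoly, mul_ite, mul_one, mul_zero, Finset.sum_ite_eq', h0, if_true, e]
    have key := prod_range_telescope s _ hL ℓ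
    rw [Finset.prod_range_succ, extendFin_of_le lam le_rfl, pow_zero, pow_zero, mul_one,
      mul_one] at key
    simp only [branchWeight, Pi.zero_apply, Nat.sub_zero, Nat.zero_max]
    rw [key]
    refine Finset.prod_congr rfl fun i _ => ?_
    rw [← pow_add, Nat.add_sub_cancel' (hL i.le_succ)]
  | succ n ih =>
    simp only [branchPoly]
    rw [branchWeight_comm_apply lam hlam (s 0) (fun _ => x (n + 1)) (fun i => s (i + 1))
        (fun i => s (i + 1)) (fun i => Or.inl ⟨rfl, rfl⟩),
      ← branchWeight_comm_apply lam hlam (x (n + 1)) s (fun i => s (i + 1)) s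
        (fun i => Or.inr ⟨rfl, rfl⟩)]
    refine Finset.sum_congr rfl fun ν hν => ?_
    rw [ih ν (Finset.mem_filter.mp hν).2]

/-- The entry of a filling in row `r` and column `c`, extended by `0` outside the diagram. -/
def fillEntry {ℓ n : ℕ} {lam : ℕ → ℕ} (T : YBox ℓ lam → Fin (n + 1)) (r c : ℕ) : ℕ :=
  if h : ∃ _ : r < ℓ, c < lam r then (T ⟨⟨r, h.1⟩, ⟨c, h.2⟩⟩ : ℕ) else 0

theorem fillEntry_of_lt {ℓ n : ℕ} {lam : ℕ → ℕ} (T : YBox ℓ lam → Fin (n + 1)) {r c : ℕ}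
    (hr : r < ℓ) (hc : c < lam r) : fillEntry T r c = T ⟨⟨r, hr⟩, ⟨c, hc⟩⟩ :=
  dif_pos ⟨hr, hc⟩

theorem fillEntry_le {ℓ n : ℕ} {lam : ℕ → ℕ} (T : YBox ℓ lam → Fin (n + 1)) (r c : ℕ) :
    fillEntry T r c ≤ n := by
  unfold fillEntry
  split_ifs
  · exact Nat.lt_succ_iff.mp (Fin.is_lt _)
  · exact Nat.zero_le n

theorem filling_ext {ℓ n : ℕ} {lam : ℕ → ℕ} {T T' : YBox ℓ lam → Fin (n + 1)}
    (h : ∀ r c, r < ℓ → c < lam r → fillEntry T r c = fillEntry T' r c) : T = T' := by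
  funext ⟨r, c⟩
  have := h r c r.2 c.2
  rw [fillEntry_of_lt T r.2 c.2, fillEntry_of_lt T' r.2 c.2] at this
  exact Fin.ext this

theorem isSkewRPP_zero_iff {ℓ n : ℕ} {lam : ℕ → ℕ} (T : YBox ℓ lam → Fin (n + 1)) :
    IsSkewRPP ℓ n lam (fun _ => 0) T ↔
      (∀ r c, r < ℓ → c < lam r → 1 ≤ fillEntry T r c) ∧
      (∀ r c c', r < ℓ → c ≤ c' → c' < lam r → fillEntry T r c ≤ fillEntry T r c') ∧
      (∀ r r' c, r ≤ r' → r' < ℓ → c < lam r → c < lam r' →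
        fillEntry T r c ≤ fillEntry T r' c) := by
  constructor
  · rintro ⟨h1, h2, h3⟩
    refine ⟨fun r c hr hc => ?_, fun r c c' hr hcc hc => ?_, fun r r' c hrr hr hc hc' => ?_⟩
    · rw [fillEntry_of_lt T hr hc, Nat.one_le_iff_ne_zero]
      exact fun h => Nat.not_lt_zero _ ((h1 _).1 h)
    · rw [fillEntry_of_lt T hr (hcc.trans_lt hc), fillEntry_of_lt T hr hc]
      exact h2 ⟨r, hr⟩ ⟨c, _⟩ ⟨c', hc⟩ (Nat.zero_le _) hcc
    · rw [fillEntry_of_lt T (hrr.trans_lt hr) hc, fillEntry_of_lt T hr hc']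
      exact h3 ⟨r, _⟩ ⟨r', hr⟩ ⟨c, hc⟩ ⟨c, hc'⟩ hrr rfl (Nat.zero_le _) (Nat.zero_le _)
  · rintro ⟨h1, h2, h3⟩
    refine ⟨fun b => ?_, fun r c c' _ hcc => ?_, fun r r' c c' hrr hcc _ _ => ?_⟩
    · have := h1 b.1 b.2 b.1.2 b.2.2
      rw [fillEntry_of_lt T b.1.2 b.2.2] at this
      simpa using Nat.one_le_iff_ne_zero.mp this
    · have := h2 r c c' r.2 hcc c'.2
      rwa [fillEntry_of_lt T r.2 c.2, fillEntry_of_lt T r.2 c'.2] at this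
    · obtain ⟨c', hc'⟩ := c'
      obtain rfl : (c : ℕ) = c' := hcc
      have := h3 r r' c hrr r'.2 c.2 hc'
      rwa [fillEntry_of_lt T r.2 c.2, fillEntry_of_lt T r'.2 hc'] at this

/-- The weight of the box in row `r` and column `c`, in terms of the entries `e`. -/
def entryWeight {R : Type*} [CommRing R] (ℓ : ℕ) (lam : ℕ → ℕ) (x t : ℕ → R) (e : ℕ → ℕ → ℕ)
    (r c : ℕ) : R :=
  if r + 1 < ℓ ∧ c < lam (r + 1) ∧ e (r + 1) c = e r c then t (r + 1) else x (e r c)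

theorem prod_boxWeight {R : Type*} [CommRing R] {ℓ n : ℕ} {lam : ℕ → ℕ} (x t : ℕ → R)
    (T : YBox ℓ lam → Fin (n + 1)) :
    ∏ b : YBox ℓ lam, boxWeight ℓ n lam (fun _ => 0) x t T b =
      ∏ r ∈ Finset.range ℓ, ∏ c ∈ Finset.range (lam r),
        entryWeight ℓ lam x t (fillEntry T) r c := by
  rw [Fintype.prod_sigma, Finset.prod_range]
  refine Finset.prod_congr rfl fun r _ => ?_
  rw [Finset.prod_range]
  refine Finset.prod_congr rfl fun c _ => ?_
  rw [boxWeight, if_pos (Nat.zero_le _), entryWeight, fillEntry_of_lt T r.2 c.2]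
  refine if_congr ?_ rfl rfl
  constructor
  · rintro ⟨hr, hc, h⟩
    exact ⟨hr, hc, by rw [fillEntry_of_lt T hr hc, h]⟩
  · rintro ⟨hr, hc, h⟩
    rw [fillEntry_of_lt T hr hc] at h
    exact ⟨hr, hc, Fin.ext h⟩

theorem prod_Ico_ite_lt {R : Type*} [CommRing R] {a b d : ℕ} (hd : d ≤ b) (p q : R) :
    ∏ c ∈ Finset.Ico a b, (if c < d then p else q) = p ^ (d - a) * q ^ (b - max a d) := by
  have h1 : (Finset.Ico a b).filter (fun c => c < d) = Finset.Ico a d := by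
    ext c
    rw [Finset.mem_filter, Finset.mem_Ico, Finset.mem_Ico]
    omega
  have h2 : (Finset.Ico a b).filter (fun c => ¬ c < d) = Finset.Ico (max a d) b := by
    ext c
    rw [Finset.mem_filter, Finset.mem_Ico, Finset.mem_Ico]
    omega
  rw [Finset.prod_ite, h1, h2]
  simp

/-- The entries of `e` that are at most `n` fill exactly the subdiagram `N` of `lam`. -/
def IsSubshape (ℓ n : ℕ) (lam N : ℕ → ℕ) (e : ℕ → ℕ → ℕ) : Prop :=
  ∀ r c, r < ℓ → c < lam r → (e r c ≤ n ↔ c < N r)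

theorem prod_entryWeight {R : Type*} [CommRing R] {ℓ n : ℕ} (lam : ℕ → ℕ)
    (hlam : ∀ a b : ℕ, a ≤ b → b < ℓ → lam b ≤ lam a) (N : ℕ → ℕ)
    (hN : Antitone N) (hNlam : ∀ r < ℓ, N r ≤ lam r) (x t : ℕ → R) (e e' : ℕ → ℕ → ℕ)
    (he : IsSubshape ℓ n lam N e) (hle : ∀ r c, e r c ≤ n + 1)
    (hee : ∀ r c, r < ℓ → c < N r → e' r c = e r c) :
    ∏ r ∈ Finset.range ℓ, ∏ c ∈ Finset.range (lam r), entryWeight ℓ lam x t e r c =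
      branchWeight ℓ (fun _ => x (n + 1)) (fun i => t (i + 1))
          (extendFin ℓ fun i : Fin ℓ => lam i) N *
        ∏ r ∈ Finset.range ℓ, ∏ c ∈ Finset.range (N r), entryWeight ℓ N x t e' r c := by
  have htop : ∀ r c, r < ℓ → c < lam r → N r ≤ c → e r c = n + 1 := fun r c hr hc hNc => by
    have := (he r c hr hc).not.mpr (by omega)
    have := hle r c
    omega
  rw [branchWeight, ← Finset.prod_mul_distrib]
  refine Finset.prod_congr rfl fun r hr => ?_
  rw [Finset.mem_range] at hr
  have hnext : ∀ c, c < extendFin ℓ (fun i : Fin ℓ => lam i) (r + 1) ↔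
      r + 1 < ℓ ∧ c < lam (r + 1) := fun c => by
    unfold extendFin
    split_ifs with h <;> simp [h]
  have hnext_le : extendFin ℓ (fun i : Fin ℓ => lam i) (r + 1) ≤ lam r := by
    refine le_of_forall_lt fun c hc => ?_
    obtain ⟨h1, h2⟩ := (hnext c).1 hc
    exact h2.trans_le (hlam _ _ r.le_succ h1)
  rw [← Finset.prod_range_mul_prod_Ico _ (hNlam r hr), mul_comm, extendFin_of_lt _ hr,
    ← prod_Ico_ite_lt hnext_le]
  congr 1
  · refine Finset.prod_congr rfl fun c hc => ?_
    obtain ⟨hc1, hc2⟩ := Finset.mem_Ico.mp hc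
    rw [entryWeight, htop r c hr hc2 hc1]
    refine if_congr ?_ rfl rfl
    rw [hnext]
    refine ⟨fun h => ⟨h.1, h.2.1⟩, fun h => ⟨h.1, h.2, ?_⟩⟩
    exact htop (r + 1) c h.1 h.2 ((hN r.le_succ).trans hc1)
  · refine Finset.prod_congr rfl fun c hc => ?_
    have hc1 := Finset.mem_range.mp hc
    have hc2 := hc1.trans_le (hNlam r hr)
    rw [entryWeight, entryWeight, hee r c hr hc1]
    refine if_congr ⟨fun h => ?_, fun h => ?_⟩ rfl rfl
    · have h3 : c < N (r + 1) := by
        rw [← he (r + 1) c h.1 h.2.1, h.2.2, he r c hr hc2]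
        exact hc1
      exact ⟨h.1, h3, by rw [hee _ c h.1 h3, h.2.2]⟩
    · exact ⟨h.1, h.2.1.trans_le (hNlam _ h.1), by rw [← hee _ c h.1 h.2.1, h.2.2]⟩

theorem filter_range_eq_range_card (p : ℕ → Prop) [DecidablePred p] (l : ℕ)
    (hp : ∀ c c', c ≤ c' → c' < l → p c' → p c) :
    (Finset.range l).filter p = Finset.range ((Finset.range l).filter p).card := by
  set S := (Finset.range l).filter p with hS
  have hlow : ∀ c ∈ S, Finset.range (c + 1) ⊆ S := fun c hc d hd => by
    rw [hS, Finset.mem_filter, Finset.mem_range] at hc ⊢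
    have := Finset.mem_range.mp hd
    exact ⟨by omega, hp d c (by omega) hc.1 hc.2⟩
  ext c
  rw [Finset.mem_range]
  refine ⟨fun hc => ?_, fun hc => ?_⟩
  · simpa using Finset.card_le_card (hlow c hc)
  · by_contra hcS
    have hsub : S ⊆ Finset.range c := fun d hd => by
      rw [Finset.mem_range]
      by_contra hdc
      exact hcS (hlow d hd (Finset.mem_range.mpr (by omega)))
    have := Finset.card_le_card hsub
    rw [Finset.card_range] at this
    omega

/-- The row lengths of the subdiagram of boxes with entry at most `n`. -/
def subshape (ℓ n : ℕ) (lam : ℕ → ℕ) (e : ℕ → ℕ → ℕ) (r : Fin ℓ) : ℕ :=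
  ((Finset.range (lam r)).filter fun c => e r c ≤ n).card

theorem isSubshape_subshape {ℓ n : ℕ} {lam : ℕ → ℕ} {e : ℕ → ℕ → ℕ}
    (h : ∀ r c c', r < ℓ → c ≤ c' → c' < lam r → e r c ≤ e r c') :
    IsSubshape ℓ n lam (extendFin ℓ (subshape ℓ n lam e)) e := by
  intro r c hr hc
  rw [extendFin_of_lt _ hr, subshape, ← Finset.mem_range,
    ← filter_range_eq_range_card (fun c => e r c ≤ n) (lam r)]
  · simp [hc]
  · exact fun c c' hcc hc' h' => (h r c c' hr hcc hc').trans h'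

theorem subshape_eq {ℓ n : ℕ} {lam : ℕ → ℕ} {e : ℕ → ℕ → ℕ} {ν : Fin ℓ → ℕ}
    (hν : ∀ r : Fin ℓ, ν r ≤ lam r) (h : IsSubshape ℓ n lam (extendFin ℓ ν) e) :
    subshape ℓ n lam e = ν := by
  funext r
  have : (Finset.range (lam r)).filter (fun c => e r c ≤ n) = Finset.range (ν r) := by
    ext c
    rw [Finset.mem_filter, Finset.mem_range, Finset.mem_range]
    constructor
    · rintro ⟨h1, h2⟩
      have := (h r c r.2 h1).1 h2
      rwa [extendFin_val] at this
    · intro hc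
      have hc' := hc.trans_le (hν r)
      exact ⟨hc', (h r c r.2 hc').2 (by rwa [extendFin_val])⟩
  rw [subshape, this, Finset.card_range]

/-- The restriction of a filling to a subdiagram, with entries truncated at `n`. -/
def restrictFilling {ℓ n : ℕ} {lam : ℕ → ℕ} (N : ℕ → ℕ) (T : YBox ℓ lam → Fin (n + 2)) :
    YBox ℓ N → Fin (n + 1) :=
  fun b => ⟨min (fillEntry T b.1 b.2) n, by omega⟩

/-- The extension of a filling to a larger diagram by the entry `n + 1`. -/
def extendFilling {ℓ n : ℕ} {N : ℕ → ℕ} (lam : ℕ → ℕ) (T : YBox ℓ N → Fin (n + 1)) :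
    YBox ℓ lam → Fin (n + 2) :=
  fun b => ⟨if (b.2 : ℕ) < N b.1 then fillEntry T b.1 b.2 else n + 1, by
    have := fillEntry_le T b.1 b.2
    split_ifs <;> omega⟩

theorem fillEntry_restrictFilling {ℓ n : ℕ} {lam N : ℕ → ℕ} {T : YBox ℓ lam → Fin (n + 2)}
    (hN : ∀ r < ℓ, N r ≤ lam r) (hT : IsSubshape ℓ n lam N (fillEntry T)) {r c : ℕ}
    (hr : r < ℓ) (hc : c < N r) :
    fillEntry (restrictFilling N T) r c = fillEntry T r c := by
  rw [fillEntry_of_lt _ hr hc]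
  exact min_eq_left ((hT r c hr (hc.trans_le (hN r hr))).2 hc)

theorem fillEntry_extendFilling {ℓ n : ℕ} {lam N : ℕ → ℕ} (T : YBox ℓ N → Fin (n + 1)) {r c : ℕ}
    (hr : r < ℓ) (hc : c < lam r) :
    fillEntry (extendFilling lam T) r c = if c < N r then fillEntry T r c else n + 1 := by
  rw [fillEntry_of_lt _ hr hc]
  rfl

theorem isSubshape_extendFilling {ℓ n : ℕ} {lam N : ℕ → ℕ} (T : YBox ℓ N → Fin (n + 1)) :
    IsSubshape ℓ n lam N (fillEntry (extendFilling lam T)) := by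
  intro r c hr hc
  rw [fillEntry_extendFilling T hr hc]
  have := fillEntry_le T r c
  split_ifs with h <;> simp [h, this]

theorem isSkewRPP_restrictFilling {ℓ n : ℕ} {lam N : ℕ → ℕ} {T : YBox ℓ lam → Fin (n + 2)}
    (hN : ∀ r < ℓ, N r ≤ lam r) (hT : IsSubshape ℓ n lam N (fillEntry T))
    (h : IsSkewRPP ℓ (n + 1) lam (fun _ => 0) T) :
    IsSkewRPP ℓ n N (fun _ => 0) (restrictFilling N T) := by
  rw [isSkewRPP_zero_iff] at h ⊢
  obtain ⟨h1, h2, h3⟩ := h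
  refine ⟨fun r c hr hc => ?_, fun r c c' hr hcc hc => ?_, fun r r' c hrr hr hc hc' => ?_⟩
  · rw [fillEntry_restrictFilling hN hT hr hc]
    exact h1 r c hr (hc.trans_le (hN r hr))
  · rw [fillEntry_restrictFilling hN hT hr hc,
      fillEntry_restrictFilling hN hT hr (hcc.trans_lt hc)]
    exact h2 r c c' hr hcc (hc.trans_le (hN r hr))
  · have hr0 := hrr.trans_lt hr
    rw [fillEntry_restrictFilling hN hT hr hc', fillEntry_restrictFilling hN hT hr0 hc]
    exact h3 r r' c hrr hr (hc.trans_le (hN r hr0)) (hc'.trans_le (hN r' hr))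

theorem isSkewRPP_extendFilling {ℓ n : ℕ} {lam N : ℕ → ℕ} {T : YBox ℓ N → Fin (n + 1)}
    (hN : Antitone N) (h : IsSkewRPP ℓ n N (fun _ => 0) T) :
    IsSkewRPP ℓ (n + 1) lam (fun _ => 0) (extendFilling lam T) := by
  rw [isSkewRPP_zero_iff] at h ⊢
  obtain ⟨h1, h2, h3⟩ := h
  refine ⟨fun r c hr hc => ?_, fun r c c' hr hcc hc => ?_, fun r r' c hrr hr hc hc' => ?_⟩
  · rw [fillEntry_extendFilling T hr hc]
    split_ifs with hcN
    · exact h1 r c hr hcN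
    · omega
  · by_cases hcN : c' < N r
    · rw [fillEntry_extendFilling T hr hc, fillEntry_extendFilling T hr (hcc.trans_lt hc),
        if_pos hcN, if_pos (hcc.trans_lt hcN)]
      exact h2 r c c' hr hcc hcN
    · rw [fillEntry_extendFilling T hr hc, if_neg hcN]
      exact fillEntry_le _ _ _
  · by_cases hcN : c < N r'
    · rw [fillEntry_extendFilling T hr hc', fillEntry_extendFilling T (hrr.trans_lt hr) hc,
        if_pos hcN, if_pos (hcN.trans_le (hN hrr))]
      exact h3 r r' c hrr hr (hcN.trans_le (hN hrr)) hcN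
    · rw [fillEntry_extendFilling T hr hc', if_neg hcN]
      exact fillEntry_le _ _ _

theorem subshape_mem_partitionsBetween {ℓ n : ℕ} {lam : ℕ → ℕ}
    (hlam : ∀ a b : ℕ, a ≤ b → b < ℓ → lam b ≤ lam a) {T : YBox ℓ lam → Fin (n + 2)}
    (h : IsSkewRPP ℓ (n + 1) lam (fun _ => 0) T) :
    subshape ℓ n lam (fillEntry T) ∈ partitionsBetween 0 (fun i : Fin ℓ => lam i) := by
  obtain ⟨-, h2, h3⟩ := (isSkewRPP_zero_iff T).1 h
  have hle : subshape ℓ n lam (fillEntry T) ≤ fun i : Fin ℓ => lam i := fun r => by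
    simpa [subshape] using Finset.card_filter_le (Finset.range (lam r)) _
  rw [partitionsBetween, Finset.mem_filter, Finset.mem_Icc]
  refine ⟨⟨fun _ => Nat.zero_le _, hle⟩, fun r r' hrr => Finset.card_le_card fun c hc => ?_⟩
  rw [Finset.mem_filter, Finset.mem_range] at hc ⊢
  have hc1 := hc.1.trans_le (hlam r r' hrr r'.2)
  exact ⟨hc1, (h3 r r' c hrr r'.2 hc1 hc.1).trans hc.2⟩

theorem dualGroth_succ {R : Type*} [CommRing R] {ℓ n : ℕ} (lam : ℕ → ℕ)
    (hlam : ∀ a b : ℕ, a ≤ b → b < ℓ → lam b ≤ lam a) (x t : ℕ → R) :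
    dualGroth ℓ (n + 1) lam (fun _ => 0) x t =
      ∑ ν ∈ partitionsBetween 0 (fun i : Fin ℓ => lam i),
        branchWeight ℓ (fun _ => x (n + 1)) (fun i => t (i + 1))
            (extendFin ℓ fun i : Fin ℓ => lam i) (extendFin ℓ ν) *
          dualGroth ℓ n (extendFin ℓ ν) (fun _ => 0) x t := by
  rw [dualGroth, ← Finset.sum_fiberwise_of_maps_to
    (g := fun T => subshape ℓ n lam (fillEntry T)) fun T hT =>
      subshape_mem_partitionsBetween hlam (Finset.mem_filter.mp hT).2]
  refine Finset.sum_congr rfl fun ν hν => ?_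
  rw [partitionsBetween, Finset.mem_filter, Finset.mem_Icc] at hν
  obtain ⟨⟨-, hνle⟩, hνanti⟩ := hν
  have hN : ∀ r < ℓ, extendFin ℓ ν r ≤ lam r := fun r hr => by
    rw [extendFin_of_lt _ hr]
    exact hνle _
  have hsub : ∀ T : YBox ℓ lam → Fin (n + 2),
      IsSkewRPP ℓ (n + 1) lam (fun _ => 0) T ∧ subshape ℓ n lam (fillEntry T) = ν →
        IsSubshape ℓ n lam (extendFin ℓ ν) (fillEntry T) := by
    rintro T ⟨hT, rfl⟩
    exact isSubshape_subshape ((isSkewRPP_zero_iff T).1 hT).2.1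
  rw [dualGroth, Finset.mul_sum]
  refine Finset.sum_nbij' (restrictFilling (extendFin ℓ ν)) (extendFilling lam) ?_ ?_ ?_ ?_ ?_
  · intro T hT
    simp only [Finset.mem_filter, Finset.mem_univ, true_and] at hT ⊢
    exact isSkewRPP_restrictFilling hN (hsub T hT) hT.1
  · intro T hT
    simp only [Finset.mem_filter, Finset.mem_univ, true_and] at hT ⊢
    exact ⟨isSkewRPP_extendFilling (extendFin_antitone hνanti) hT,
      subshape_eq hνle (isSubshape_extendFilling T)⟩
  · intro T hT
    simp only [Finset.mem_filter, Finset.mem_univ, true_and] at hT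
    have hT' := hsub T hT
    refine filling_ext fun r c hr hc => ?_
    rw [fillEntry_extendFilling _ hr hc]
    split_ifs with hcN
    · exact fillEntry_restrictFilling hN hT' hr hcN
    · have h1 := (hT' r c hr hc).not.mpr hcN
      have h2 := fillEntry_le T r c
      omega
  · intro T _
    refine filling_ext fun r c hr hc => ?_
    rw [fillEntry_restrictFilling hN (isSubshape_extendFilling T) hr hc,
      fillEntry_extendFilling T hr (hc.trans_le (hN r hr)), if_pos hc]
  · intro T hT
    simp only [Finset.mem_filter, Finset.mem_univ, true_and] at hT
    have hT' := hsub T hT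
    rw [prod_boxWeight, prod_boxWeight]
    exact prod_entryWeight lam hlam _ (extendFin_antitone hνanti) hN x t _ _ hT' (fillEntry_le T)
      fun r c hr hc => fillEntry_restrictFilling hN hT' hr hc

theorem dualGroth_zero {R : Type*} [CommRing R] {ℓ : ℕ} (lam : ℕ → ℕ) (x t : ℕ → R) :
    dualGroth ℓ 0 lam (fun _ => 0) x t = if (fun i : Fin ℓ => lam i) = 0 then 1 else 0 := by
  split_ifs with h
  · have : IsEmpty (YBox ℓ lam) := ⟨fun b => by
      have h1 : lam b.1 = 0 := congrFun h b.1
      have h2 := b.2.2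
      omega⟩
    rw [dualGroth, Finset.filter_true_of_mem fun T _ =>
      ⟨isEmptyElim, fun r c => isEmptyElim (⟨r, c⟩ : YBox ℓ lam),
        fun r _ c => isEmptyElim (⟨r, c⟩ : YBox ℓ lam)⟩]
    simp
  · obtain ⟨r, hr⟩ := Function.ne_iff.mp h
    rw [dualGroth, Finset.filter_false_of_mem, Finset.sum_empty]
    intro T _ hT
    exact Nat.not_lt_zero _ ((hT.1 ⟨r, ⟨0, Nat.pos_of_ne_zero hr⟩⟩).1 (by omega))

theorem dualGroth_eq_branchPoly {R : Type*} [CommRing R] {ℓ : ℕ} (n : ℕ) (lam : ℕ → ℕ)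
    (hlam : ∀ a b : ℕ, a ≤ b → b < ℓ → lam b ≤ lam a) (x t : ℕ → R) :
    dualGroth ℓ n lam (fun _ => 0) x t =
      branchPoly x (fun i => t (i + 1)) n (fun i : Fin ℓ => lam i) := by
  induction n generalizing lam with
  | zero => exact dualGroth_zero lam x t
  | succ n ih =>
    rw [dualGroth_succ lam hlam, branchPoly]
    refine Finset.sum_congr rfl fun ν hν => ?_
    have hν' := extendFin_antitone (Finset.mem_filter.mp hν).2
    rw [ih _ fun a b hab _ => hν' hab]
    simp only [extendFin_val]

theorem branchWeight_same {R : Type*} [CommRing R] {ℓ : ℕ} (s : ℕ → R) (L N : ℕ → ℕ)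
    (hL : Antitone L) :
    branchWeight ℓ s s L N = ∏ i ∈ Finset.range ℓ, s i ^ (L i - N i) := by
  refine Finset.prod_congr rfl fun i _ => ?_
  have : L (i + 1) ≤ L i := hL i.le_succ
  rw [← pow_add]
  congr 1
  omega

/-- **Branching rule for refined dual Grothendieck polynomials.**
`g_λ(x_1,…,x_n,γ; t_1,…,t_{ℓ-1})
   = Σ_{μ ⊆ λ} γ^{λ_1-μ_1} (∏_{i=2}^{ℓ} t_{i-1}^{λ_i-μ_i})
       g_μ(x_1,…,x_n; γ,t_1,…,t_{ℓ-2})`,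
the sum being over partitions `μ` contained in `λ`, encoded as antitone
dependent tuples `p` with `p i ≤ λ_{i+1}`.  On the right-hand side the
parameter alphabet is `(γ, t_1, t_2, …)`. -/
theorem refined_dual_grothendieck_branching
    {R : Type*} [CommRing R] (ℓ n : ℕ) (hl : 1 ≤ ℓ) (lam : ℕ → ℕ)
    (hlam : ∀ a b : ℕ, a ≤ b → b < ℓ → lam b ≤ lam a)
    (x t : ℕ → R) (γ : R) :
    dualGroth ℓ (n + 1) lam (fun _ => 0)
        (fun k => if k = n + 1 then γ else x k) t =
      ∑ p ∈ Finset.univ.filter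
          (fun p : (i : Fin ℓ) → Fin (lam i.1 + 1) =>
            ∀ i j : Fin ℓ, (i : ℕ) ≤ (j : ℕ) → (p j : ℕ) ≤ (p i : ℕ)),
        γ ^ (lam 0 - extendDep ℓ lam p 0) *
          (∏ r ∈ Finset.Ico 1 ℓ, t r ^ (lam r - extendDep ℓ lam p r)) *
          dualGroth ℓ n (extendDep ℓ lam p) (fun _ => 0) x
            (fun k => if k = 1 then γ else t (k - 1)) := by
  have hanti : Antitone (fun i : Fin ℓ => lam i) := fun a b hab => hlam a b hab b.2
  set s : ℕ → R := fun i => if i = 0 then γ else t i with hs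
  have hst : (fun i => t (i + 1)) = fun i => s (i + 1) := by
    funext i
    simp [hs]
  rw [dualGroth_eq_branchPoly (n + 1) lam hlam, branchPoly, if_pos rfl]
  simp_rw [branchPoly_congr (x := fun k => if k = n + 1 then γ else x k) (x' := x)
    (fun i => t (i + 1)) (n := n) fun k hk => if_neg (by omega)]
  rw [hst]
  refine (sum_branchWeight_mul_branchPoly x s n _ hanti).trans (Eq.symm ?_)
  refine Finset.sum_bij (fun p _ i => (p i : ℕ)) ?_ ?_ ?_ ?_
  · intro p hp
    rw [Finset.mem_filter] at hp
    rw [partitionsBetween, Finset.mem_filter, Finset.mem_Icc]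
    exact ⟨⟨fun _ => Nat.zero_le _, fun i => Nat.lt_succ_iff.mp (p i).2⟩,
      fun i j hij => hp.2 i j hij⟩
  · intro p _ q _ hpq
    funext i
    exact Fin.ext (congrFun hpq i)
  · intro ν hν
    rw [partitionsBetween, Finset.mem_filter, Finset.mem_Icc] at hν
    exact ⟨fun i => ⟨ν i, Nat.lt_succ_iff.mpr (hν.1.2 i)⟩,
      Finset.mem_filter.mpr ⟨Finset.mem_univ _, fun i j hij => hν.2 hij⟩, rfl⟩
  · intro p hp
    have hp' : Antitone (fun i : Fin ℓ => (p i : ℕ)) := (Finset.mem_filter.mp hp).2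
    have hext : extendDep ℓ lam p = extendFin ℓ fun i => (p i : ℕ) := rfl
    rw [hext, dualGroth_eq_branchPoly n _ fun a b hab _ => extendFin_antitone hp' hab,
      branchWeight_same s _ _ (extendFin_antitone hanti)]
    simp only [extendFin_val]
    congr 1
    · rw [Finset.range_eq_Ico, Finset.prod_eq_prod_Ico_succ_bot (Nat.lt_of_succ_le hl),
        extendFin_of_lt (fun i : Fin ℓ => lam i) hl]
      congr 1
      refine Finset.prod_congr rfl fun r hr => ?_
      obtain ⟨h1, h2⟩ := Finset.mem_Ico.mp hr
      rw [extendFin_of_lt (fun i : Fin ℓ => lam i) h2, hs]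
      dsimp only
      rw [if_neg (by omega)]
    · congr 1
      funext i
      simp [hs]

end
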